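/- arXiv:2208.10103 — 6 statements merged into one kernel-verified Lean document; each statement's English description precedes it below -/
import Mathlib

section
/- Let N ≥ 2 be a natural number, C > 0 a real number (the bottleneck capacity), and for each i ∈ {1,…,N} let d_i > 0 (propagation delay), D_i ≥ 0 (total queuing delay), Δ_i := 2·d_i/(d_i + D_i), and x_i > 0 (bottleneck-bandwidth estimate). Then the BBRv1 single-bottleneck equilibrium conditions — for every i, x_i = max(1, 1/Δ_i)·(C − Σ_{j≠i} min(1, Δ_j)·x_j) and x_i = C − max(4/5, 1/Δ_i)·Σ_{j≠i} min(1, Δ_j)·x_j — hold if and only if d_i = D_i for every i and Σ_{i=1}^N x_i = C. (In particular, BBRv1 is in equilibrium exactly when the propagation delay equals the queuing delay for every sender, and the equilibrium may be arbitrarily unfair.) -/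
/-- If the two equilibrium maps of a single sender with window factor `δ` agree, for positive
capacity `C` and positive competing rate `S`, then the window equals the bandwidth-delay product. -/
theorem window_factor_eq_one {δ C S : ℝ} (hδ : 0 < δ) (hC : 0 < C) (hS : 0 < S)
    (h : max 1 (1 / δ) * (C - S) = C - max (4 / 5) (1 / δ) * S) : δ = 1 := by
  rcases lt_trichotomy δ 1 with hlt | heq | hgt
  · have h1 : 1 < 1 / δ := by rwa [lt_div_iff₀ hδ, one_mul]
    rw [max_eq_right h1.le, max_eq_right (by linarith)] at h
    nlinarith
  · exact heq
  · have h1 : 1 / δ < 1 := by rwa [div_lt_one hδ]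
    have hM : max (4 / 5) (1 / δ) < 1 := max_lt (by norm_num) h1
    rw [max_eq_left h1.le] at h
    nlinarith

/-- **BBRv1 equilibrium (Theorem 1, algebraic core).**
`N ≥ 2` BBRv1 senders sharing a bottleneck of capacity `C`, with propagation
delays `d i > 0`, queuing delays `D i ≥ 0`, congestion-window factors
`Δ i = 2 d i / (d i + D i)` and bandwidth estimates `x i > 0`, are in
equilibrium iff `d i = D i` for every `i` and `∑ i, x i = C`. -/
theorem bbrv1_equilibrium_iff
    (N : ℕ) (hN : 2 ≤ N) (C : ℝ) (hC : 0 < C)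
    (d D x : Fin N → ℝ)
    (hd : ∀ i, 0 < d i) (hD : ∀ i, 0 ≤ D i) (hx : ∀ i, 0 < x i)
    (Δ : Fin N → ℝ) (hΔ : ∀ i, Δ i = 2 * d i / (d i + D i)) :
    ((∀ i, x i =
        max 1 (1 / Δ i) *
          (C - ∑ j ∈ Finset.univ.erase i, min 1 (Δ j) * x j)) ∧
     (∀ i, x i =
        C - max (4/5) (1 / Δ i) *
          ∑ j ∈ Finset.univ.erase i, min 1 (Δ j) * x j))
      ↔ ((∀ i, d i = D i) ∧ ∑ i, x i = C) := by
  have hpos : ∀ i, 0 < Δ i := fun i => by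
    rw [hΔ i]
    have := hd i
    have := hD i
    positivity
  have hone : ∀ i, Δ i = 1 ↔ d i = D i := fun i => by
    have := hd i
    have := hD i
    rw [hΔ i, div_eq_one_iff_eq (by positivity)]
    constructor <;> intro h <;> linarith
  have hsum : ∀ i, ∑ j ∈ Finset.univ.erase i, x j + x i = ∑ j, x j := fun i =>
    Finset.sum_erase_add _ _ (Finset.mem_univ i)
  constructor
  · rintro ⟨h₁, h₂⟩
    have hΔ1 : ∀ i, Δ i = 1 := fun i => by
      refine window_factor_eq_one (hpos i) hC ?_ ((h₁ i).symm.trans (h₂ i))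
      refine Finset.sum_pos (fun j _ => mul_pos (lt_min one_pos (hpos j)) (hx j)) ?_
      rw [← Finset.card_pos, Finset.card_erase_of_mem (Finset.mem_univ i), Finset.card_univ,
        Fintype.card_fin]
      omega
    refine ⟨fun i => (hone i).1 (hΔ1 i), ?_⟩
    have h := h₁ ⟨0, by omega⟩
    simp only [hΔ1, div_one, max_self, min_self, one_mul] at h
    linarith [hsum ⟨0, by omega⟩]
  · rintro ⟨hdD, hxC⟩
    have hΔ1 : ∀ i, Δ i = 1 := fun i => (hone i).2 (hdD i)
    have hmax : max (4 / 5 : ℝ) 1 = 1 := max_eq_right (by norm_num)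
    simp only [hΔ1, div_one, max_self, min_self, one_mul, hmax]
    constructor <;> intro i <;> linarith [hsum i]
end

section
/- Let N ≥ 1 be a natural number, C > 0 a real number, and x_1, …, x_N real numbers with x_i > 0 for all i. Then the system of equations x_i = ( (5/4)·x_i·C ) / ( (5/4)·x_i + Σ_{j≠i} x_j ) for every i ∈ {1,…,N} holds if and only if x_i = 5C/(4N+1) for every i. In particular, the equilibrium is unique and perfectly fair. -/
/-- A positive rate equals its measured maximum delivery rate iff the rate plus four times the
aggregate rate is five times the capacity. -/
theorem eq_maxDeliveryRate_iff {ι : Type*} [Fintype ι] [DecidableEq ι] (C : ℝ)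
    {x : ι → ℝ} (hx : ∀ i, 0 < x i) (i : ι) :
    x i = 5 / 4 * x i * C / (5 / 4 * x i + ∑ j ∈ Finset.univ.erase i, x j)
      ↔ x i + 4 * ∑ j, x j = 5 * C := by
  have hsum := Finset.add_sum_erase Finset.univ x (Finset.mem_univ i)
  have hnonneg : 0 ≤ ∑ j ∈ Finset.univ.erase i, x j :=
    Finset.sum_nonneg fun j _ => (hx j).le
  have hi := hx i
  have hden : 5 / 4 * x i + ∑ j ∈ Finset.univ.erase i, x j ≠ 0 := by positivity
  rw [eq_div_iff hden, mul_comm (5 / 4) (x i), mul_assoc, mul_right_inj' hi.ne', ← hsum]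
  constructor <;> intro h <;> linarith

/-- **Shallow-buffer BBRv1 equilibrium (Theorem 3, equilibrium part).**
For `N ≥ 1` senders with positive rates `x i` sharing a bottleneck of
capacity `C > 0`, the shallow-buffer equilibrium conditions
`x i = (5/4)·x i·C / ((5/4)·x i + ∑_{j≠i} x j)` hold for every `i` iff
`x i = 5C/(4N+1)` for every `i` (unique and perfectly fair equilibrium). -/
theorem bbrv1_shallow_buffer_equilibrium_iff
    (N : ℕ) (hN : 1 ≤ N) (C : ℝ) (hC : 0 < C)
    (x : Fin N → ℝ) (hx : ∀ i, 0 < x i) :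
    (∀ i, x i =
        5 / 4 * x i * C / (5 / 4 * x i + ∑ j ∈ Finset.univ.erase i, x j))
      ↔ (∀ i, x i = 5 * C / (4 * N + 1)) := by
  have hpos : (0 : ℝ) < 4 * N + 1 := by positivity
  simp only [eq_maxDeliveryRate_iff C hx]
  constructor
  · intro h i
    have hfair : ∀ j, x j = x i := fun j => by linarith [h i, h j]
    have hsum : ∑ j, x j = N * x i := by simp [hfair]
    rw [eq_div_iff hpos.ne']
    linarith [hsum ▸ h i]
  · intro h i
    have hsum : ∑ j, x j = N * (5 * C / (4 * N + 1)) := by simp [h]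
    rw [hsum, h i]
    field_simp
    ring
end

section
/- Let N ≥ 2 be a natural number, C > 0 and δ > 0 real numbers, and x_1, …, x_N real numbers with x_i > 0 for all i. Then the BBRv2 equilibrium conditions — for every i, x_i = max(1, 1/δ)·(C − min(1, δ)·Σ_{j≠i} x_j) and x_i = C − (4/5)·max(1, 1/δ)·min(1, δ)·Σ_{j≠i} x_j — hold if and only if δ = (4N+1)/(5N) and x_i = 5C/(4N+1) for every i. (In particular this equilibrium is perfectly fair.) -/
theorem max_one_one_div_eq_inv_min {δ : ℝ} (hδ : 0 < δ) : max 1 (1 / δ) = (min 1 δ)⁻¹ := by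
  rcases le_total 1 δ with h | h
  · rw [min_eq_left h, inv_one, max_eq_left ((div_le_one hδ).2 h)]
  · rw [min_eq_right h, max_eq_right ((one_le_div hδ).2 h), one_div]

/-- **BBRv2 fair equilibrium (Theorem 4, algebraic core).**
For `N ≥ 2` BBRv2 senders sharing a bottleneck of capacity `C > 0`, with a
common delay factor `δ > 0` and positive rates `x i`, the equilibrium
conditions hold iff `δ = (4N+1)/(5N)` and `x i = 5C/(4N+1)` for every `i`
(a perfectly fair equilibrium). -/
theorem bbrv2_equilibrium_iff
    (N : ℕ) (hN : 2 ≤ N) (C δ : ℝ) (hC : 0 < C) (hδ : 0 < δ)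
    (x : Fin N → ℝ) (hx : ∀ i, 0 < x i) :
    ((∀ i, x i =
        max 1 (1 / δ) * (C - min 1 δ * ∑ j ∈ Finset.univ.erase i, x j)) ∧
     (∀ i, x i =
        C - 4 / 5 * max 1 (1 / δ) * min 1 δ *
          ∑ j ∈ Finset.univ.erase i, x j))
      ↔ (δ = (4 * N + 1) / (5 * N) ∧ ∀ i, x i = 5 * C / (4 * N + 1)) := by
  have hN' : (2 : ℝ) ≤ N := by exact_mod_cast hN
  have hm : 0 < min 1 δ := lt_min one_pos hδ
  have hsum : ∀ i, ∑ j ∈ Finset.univ.erase i, x j = ∑ j, x j - x i := fun i =>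
    Finset.sum_erase_eq_sub (Finset.mem_univ i)
  simp only [hsum, max_one_one_div_eq_inv_min hδ, mul_assoc, inv_mul_cancel_left₀ hm.ne']
  have hlt : (4 * N + 1 : ℝ) / (5 * N) < 1 := by
    rw [div_lt_one (by positivity)]
    linarith
  constructor
  · rintro ⟨hprobe, hcruise⟩
    have hfair : ∀ i, x i = 5 * C - 4 * ∑ j, x j := fun i => by linarith [hcruise i]
    have htotal : ∑ j, x j = N * (5 * C - 4 * ∑ j, x j) := by
      conv_lhs => rw [Finset.sum_congr rfl fun i _ => hfair i]
      simp [mul_sub]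
    have hS : ∑ j, x j = 5 * N * C / (4 * N + 1) := by
      rw [eq_div_iff (by positivity)]
      linarith
    have hcap : min 1 δ * ∑ j, x j = C := by
      have h := hprobe ⟨0, by lia⟩
      rw [eq_inv_mul_iff_mul_eq₀ hm.ne'] at h
      linarith
    have hmin : min 1 δ = (4 * N + 1) / (5 * N) := by
      rw [hS] at hcap
      field_simp at hcap ⊢
      linarith
    refine ⟨?_, fun i => ?_⟩
    · rcases min_choice 1 δ with h | h <;> linarith
    · rw [hfair i, hS]
      field_simp
      ring
  · rintro ⟨hd, hfair⟩
    have hmin : min 1 δ = (4 * N + 1) / (5 * N) := by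
      rw [min_eq_right (hd.trans_lt hlt).le, hd]
    have hS : ∑ j, x j = N * (5 * C / (4 * N + 1)) := by
      simp [hfair]
    refine ⟨fun i => ?_, fun i => ?_⟩
    · rw [hmin, hS, hfair i]
      field_simp
      ring
    · rw [hS, hfair i]
      field_simp
      ring
end

section
/- Fix real numbers d > 0 and C > 0 and a natural number N ≥ 1, and define δ(q) := d/(d + q/C) for q ≥ 0. Then δ(q) = (4N+1)/(5N) if and only if q = ((N−1)/(4N+1))·d·C. Moreover, for every N ≥ 1 one has ((N−1)/(4N+1))·d·C < (1/4)·d·C, and ((N−1)/(4N+1))·d·C tends to (1/4)·d·C as N → ∞. (Hence the BBRv2 equilibrium queue is always less than one quarter of the BBRv1 equilibrium queue d·C, a buffer-utilization reduction of at least 75%.) -/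
/-- **BBRv2 equilibrium queue (Theorem 4/5, queue comparison).**
With `δ(q) = d/(d + q/C)`, one has `δ(q) = (4N+1)/(5N)` iff
`q = ((N−1)/(4N+1))·d·C` (for `q ≥ 0`); moreover this equilibrium queue is
always less than `(1/4)·d·C` and tends to `(1/4)·d·C` as `N → ∞`. -/
theorem bbrv2_equilibrium_queue
    (d C : ℝ) (hd : 0 < d) (hC : 0 < C)
    (N : ℕ) (hN : 1 ≤ N)
    (δ : ℝ → ℝ) (hδ : ∀ q, δ q = d / (d + q / C)) :
    (∀ q : ℝ, 0 ≤ q →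
        (δ q = (4 * N + 1) / (5 * N) ↔
          q = ((N : ℝ) - 1) / (4 * N + 1) * d * C)) ∧
    ((N : ℝ) - 1) / (4 * N + 1) * d * C < 1 / 4 * d * C ∧
    Filter.Tendsto (fun n : ℕ => ((n : ℝ) - 1) / (4 * n + 1) * d * C)
      Filter.atTop (nhds (1 / 4 * d * C)) := by
  have hN' : (0 : ℝ) < N := by exact_mod_cast hN
  have key (n : ℕ) : ((n : ℝ) - 1) / (4 * n + 1) * d * C =
      (1 / 4 - 5 / 4 / (4 * (n : ℝ) + 1)) * d * C := by
    have : (4 * (n : ℝ) + 1) ≠ 0 := by positivity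
    congr 2
    field_simp
    ring
  refine ⟨fun q hq => ?_, ?_, ?_⟩
  · have hpos : 0 < d + q / C := by positivity
    have hqC : C * (q / C) = q := mul_div_cancel₀ q hC.ne'
    rw [hδ, div_eq_div_iff hpos.ne' (by positivity), mul_assoc, div_mul_eq_mul_div,
      eq_div_iff (by positivity)]
    constructor
    · intro h
      linear_combination (-C) * h - (4 * (N : ℝ) + 1) * hqC
    · intro h
      refine mul_left_cancel₀ hC.ne' ?_
      linear_combination -h - (4 * (N : ℝ) + 1) * hqC
  · rw [key]
    have : (0 : ℝ) < 5 / 4 / (4 * (N : ℝ) + 1) := by positivity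
    gcongr
    linarith
  · simp_rw [key]
    have hden : Filter.Tendsto (fun n : ℕ => 4 * (n : ℝ) + 1) Filter.atTop Filter.atTop :=
      Filter.tendsto_atTop_add_const_right _ _
        (tendsto_natCast_atTop_atTop.const_mul_atTop (by norm_num))
    simpa only [sub_zero] using
      (((hden.const_div_atTop (5 / 4)).const_sub (1 / 4)).mul_const d).mul_const C
end

section
/- Fix real numbers d > 0, C > 0 and a natural number N ≥ 1, and define δ(q) := d/(d + q/C). Define g : ℝ^N × ℝ → ℝ^N × ℝ by g_i(x, q) = ( (C − Σ_{k=1}^N x_k)/(C·(d + q/C)) + ( (5/4)·δ(q)·C )/( (5/4)·x_i + Σ_{j≠i} x_j ) − 1 )·x_i for i ∈ {1,…,N}, and g_q(x, q) = Σ_{k=1}^N x_k − C. Then at the point x_i = C/N for all i and q = ((N−1)/(4N+1))·d·C, all components of g vanish, i.e., this point is an equilibrium of the reduced BBRv2 dynamics. -/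
/-- **Fair equilibrium of the reduced BBRv2 dynamics (Theorem 4).**
All components of the reduced BBRv2 vector field `g` vanish at the point
`x i = C/N` (for all `i`), `q = ((N−1)/(4N+1))·d·C`, where
`δ(q) = d/(d + q/C)`. -/
theorem bbrv2_reduced_dynamics_equilibrium
    (d C : ℝ) (hd : 0 < d) (hC : 0 < C)
    (N : ℕ) (hN : 1 ≤ N)
    (δ : ℝ → ℝ) (hδ : ∀ q, δ q = d / (d + q / C))
    (gx : Fin N → (Fin N → ℝ) → ℝ → ℝ) (gq : (Fin N → ℝ) → ℝ → ℝ)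
    (hgx : ∀ i x q, gx i x q =
      ((C - ∑ k, x k) / (C * (d + q / C)) +
        5 / 4 * δ q * C / (5 / 4 * x i + ∑ j ∈ Finset.univ.erase i, x j)
        - 1) * x i)
    (hgq : ∀ x q, gq x q = (∑ k, x k) - C)
    (xstar : Fin N → ℝ) (hxstar : ∀ i, xstar i = C / N)
    (qstar : ℝ) (hqstar : qstar = ((N : ℝ) - 1) / (4 * N + 1) * d * C) :
    (∀ i, gx i xstar qstar = 0) ∧ gq xstar qstar = 0 := by
  have hN0 : (N : ℝ) ≠ 0 := by positivity
  have hC0 : C ≠ 0 := hC.ne'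
  have hd0 : d ≠ 0 := hd.ne'
  have hN4 : (4 * N + 1 : ℝ) ≠ 0 := by positivity
  have hsum : ∑ k, xstar k = C := by
    simp only [hxstar, Finset.sum_const, Finset.card_univ, Fintype.card_fin, nsmul_eq_mul]
    field_simp
  refine ⟨fun i => ?_, by rw [hgq, hsum, sub_self]⟩
  have herase : ∑ j ∈ Finset.univ.erase i, xstar j = C - C / N := by
    rw [Finset.sum_erase_eq_sub (Finset.mem_univ i), hsum, hxstar]
  have hδstar : δ qstar = (4 * N + 1) / (5 * N) := by
    have hdelay : d + qstar / C = d * (5 * N) / (4 * N + 1) := by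
      rw [hqstar]
      field_simp
      ring
    rw [hδ, hdelay]
    field_simp
  have hdenom : 5 / 4 * (C / N) + (C - C / N) = C * (4 * N + 1) / (4 * N) := by
    field_simp
    ring
  have hshare : 5 / 4 * ((4 * N + 1) / (5 * N)) * C / (C * (4 * N + 1) / (4 * N)) = 1 := by
    field_simp
  rw [hgx, hsum, herase, hδstar, hxstar, hdenom, hshare]
  simp
end

section
/- Fix a natural number N ≥ 1 and a real number d > 0, and set A := (4N+1)/(5·N²·d). Let J be the real (N+1)×(N+1) matrix with entries, for row/column indices i, j ∈ {1,…,N}: J_{ii} = −A − 5/(4N+1), J_{ij} = −A − 4/(4N+1) for i ≠ j, J_{i,N+1} = −A, J_{N+1,j} = 1, and J_{N+1,N+1} = 0. Then every root of the characteristic polynomial of J over ℂ lies in the set { −1/(4N+1), −1, −(4N+1)/(5·N·d) }; in particular all eigenvalues of J are real and strictly negative. -/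
open Finset in
/-- If `(x, q)` is a nonzero eigenvector, with eigenvalue `z`, of the bordered matrix with upper left
block `-c • 1 - b • (all ones)`, last column `-a`, last row `1` and corner `0`, then `z = -c` or `z`
is a root of the characteristic polynomial of the quotient acting on `(∑ i, x i, q)`. -/
theorem eq_neg_or_quadratic_of_bordered_eigenvector {K ι : Type*} [Field K] [Fintype ι]
    {a b c z q : K} {x : ι → K} (hne : q ≠ 0 ∨ x ≠ 0)
    (hx : ∀ i, z * x i = -c * x i - b * ∑ j, x j - a * q) (hq : z * q = ∑ j, x j) :
    z = -c ∨ z ^ 2 + (c + Fintype.card ι * b) * z + Fintype.card ι * a = 0 := by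
  have hsum : z * ∑ i, x i =
      -c * ∑ i, x i - Fintype.card ι * (b * ∑ j, x j) - Fintype.card ι * (a * q) := by
    rw [mul_sum, sum_congr rfl fun i _ => hx i]
    simp [sum_sub_distrib, ← mul_sum]
  by_cases hq0 : q = 0
  · left
    obtain ⟨i, hi⟩ := Function.ne_iff.1 (hne.resolve_left (not_not.2 hq0))
    have hxi := hx i
    rw [← hq, hq0] at hxi
    exact mul_right_cancel₀ hi (by linear_combination hxi)
  · right
    rw [← hq] at hsum
    exact mul_right_cancel₀ hq0 (by linear_combination hsum)

/-- **Eigenvalues of the BBRv2 Jacobian (Theorem 5, stability part).**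
Let `A = (4N+1)/(5N²d)` and let `J` be the `(N+1)×(N+1)` real matrix with
`J_{ii} = −A − 5/(4N+1)` and `J_{ij} = −A − 4/(4N+1)` for `i ≠ j` in the first
`N` rows/columns, last-column entries `J_{i,N+1} = −A`, last-row entries
`J_{N+1,j} = 1`, and `J_{N+1,N+1} = 0`. Then every root of the characteristic
polynomial of `J` over `ℂ` lies in `{−1/(4N+1), −1, −(4N+1)/(5Nd)}`; in
particular all eigenvalues of `J` are real and strictly negative. -/
theorem bbrv2_jacobian_eigenvalues
    (N : ℕ) (hN : 1 ≤ N) (d : ℝ) (hd : 0 < d)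
    (A : ℝ) (hA : A = (4 * N + 1) / (5 * N ^ 2 * d))
    (J : Matrix (Fin (N + 1)) (Fin (N + 1)) ℝ)
    (hJ : ∀ i j : Fin (N + 1), J i j =
      if (i : ℕ) < N then
        (if (j : ℕ) < N then
          (if i = j then -A - 5 / (4 * (N : ℝ) + 1)
           else -A - 4 / (4 * (N : ℝ) + 1))
         else -A)
      else (if (j : ℕ) < N then 1 else 0)) :
    ∀ z : ℂ, (J.map (algebraMap ℝ ℂ)).charpoly.IsRoot z →
      (z ∈ ({-1 / (4 * (N : ℂ) + 1), -1,
              -(4 * (N : ℂ) + 1) / (5 * (N : ℂ) * (d : ℂ))} : Set ℂ)) ∧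
      z.im = 0 ∧ z.re < 0 := by
  intro z hz
  have hn : (0 : ℝ) < N := by exact_mod_cast hN
  have hn₀ : (N : ℂ) ≠ 0 := by exact_mod_cast hn.ne'
  have hm : (4 * N + 1 : ℂ) ≠ 0 := by exact_mod_cast (4 * N).succ_ne_zero
  have hd₀ : (d : ℂ) ≠ 0 := by exact_mod_cast hd.ne'
  have hmem : z ∈ ({-1 / (4 * (N : ℂ) + 1), -1,
      -(4 * (N : ℂ) + 1) / (5 * (N : ℂ) * (d : ℂ))} : Set ℂ) := by
    rw [Polynomial.IsRoot.def, Matrix.eval_charpoly] at hz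
    obtain ⟨v, hv, hker⟩ := Matrix.exists_mulVec_eq_zero_iff.2 hz
    have heig : ∀ i, z * v i = ∑ j, (J i j : ℂ) * v j := by
      intro i
      have hi := congrFun hker i
      rw [Matrix.sub_mulVec] at hi
      simpa [Matrix.mulVec, dotProduct, Matrix.diagonal_apply, sub_eq_zero] using hi
    have hlast : z * v (Fin.last N) = ∑ j : Fin N, v j.castSucc := by
      simpa [Fin.sum_univ_castSucc, hJ] using heig (Fin.last N)
    have hinit : ∀ i : Fin N, z * v i.castSucc = -(1 / (4 * N + 1)) * v i.castSucc
        - (A + 4 / (4 * N + 1)) * ∑ j : Fin N, v j.castSucc - A * v (Fin.last N) := by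
      intro i
      have hentry : ∀ j : Fin N, (J i.castSucc j.castSucc : ℂ) * v j.castSucc =
          (if i = j then -(1 / (4 * N + 1)) * v j.castSucc else 0)
            - (A + 4 / (4 * N + 1)) * v j.castSucc := by
        intro j
        by_cases hij : i = j <;> simp [hJ, hij] <;> ring
      rw [heig, Fin.sum_univ_castSucc, Finset.sum_congr rfl fun j _ => hentry j,
        Finset.sum_sub_distrib, ← Finset.mul_sum]
      simp [hJ]
      ring
    have hne : v (Fin.last N) ≠ 0 ∨ (fun i : Fin N => v i.castSucc) ≠ 0 := by
      by_contra! h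
      exact hv (funext (Fin.lastCases h.1 (congrFun h.2)))
    simp only [Set.mem_insert_iff, Set.mem_singleton_iff]
    rcases eq_neg_or_quadratic_of_bordered_eigenvector hne hinit hlast with h | h
    · left
      rw [h, neg_div]
    · right
      have hNA : (N : ℂ) * A = (4 * N + 1) / (5 * N * d) := by
        rw [hA]
        push_cast
        field_simp
      have hone : (1 / (4 * N + 1) + N * (4 / (4 * N + 1)) : ℂ) = 1 := by
        field_simp
        ring
      rw [Fintype.card_fin] at h
      have hprod : (z + 1) * (z + (4 * N + 1) / (5 * N * d)) = 0 := by
        rw [← hNA]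
        linear_combination h - z * hone
      rcases mul_eq_zero.1 hprod with h | h
      · exact .inl (eq_neg_of_add_eq_zero_left h)
      · right
        rw [eq_neg_of_add_eq_zero_left h, neg_div]
  refine ⟨hmem, ?_⟩
  obtain ⟨r, hr, rfl⟩ : ∃ r : ℝ, r < 0 ∧ z = r := by
    rcases hmem with rfl | rfl | rfl
    · exact ⟨-1 / (4 * N + 1),
        div_neg_of_neg_of_pos (by norm_num) (by positivity), by push_cast; rfl⟩
    · exact ⟨-1, by norm_num, by norm_num⟩
    · exact ⟨-(4 * N + 1) / (5 * N * d),
        div_neg_of_neg_of_pos (by linarith) (by positivity), by push_cast; rfl⟩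
  exact ⟨Complex.ofReal_im r, hr⟩
end
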